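/- Let n be a positive natural number, E = EuclideanSpace ℝ (Fin n), and let μ and ν be probability measures on E with finite first moments (∫ ‖x‖ dμ < ∞ and ∫ ‖x‖ dν < ∞). Let W₁ = sInf { c : ℝ | ∃ π a coupling of μ and ν with (x,y) ↦ ‖x − y‖ π-integrable and c = ∫ ‖x − y‖ dπ }. Define A = { r : ℝ | ∃ f : E → ℝ differentiable, 1-Lipschitz, integrable with respect to both μ and ν, with r = ∫ f dμ − ∫ f dν }, and B = { r : ℝ | ∃ f : E → ℝ continuously differentiable, integrable with respect to both μ and ν, satisfying the Sobolev line constraint at (x, y) for every x in the support of μ and every y in the support of ν, with r = ∫ f dμ − ∫ f dν }. If sSup A = W₁ (the Kantorovich–Rubinstein duality), then sSup B = W₁ (the Sobolev duality of the Wasserstein distance). -/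

import Mathlib

open MeasureTheory

/-- The Sobolev line constraint at `(x, y)`. -/
def SobolevLineConstraint {n : ℕ} (f : EuclideanSpace ℝ (Fin n) → ℝ)
    (x y : EuclideanSpace ℝ (Fin n)) : Prop :=
  ∫ t in Set.Icc (0 : ℝ) 1, ‖gradient f (t • x + (1 - t) • y)‖ ^ 2 ≤ 1

/-- `π` is a coupling of `μ` and `ν`: its marginals are `μ` and `ν`. -/
def IsCoupling {n : ℕ} (μ ν : Measure (EuclideanSpace ℝ (Fin n)))
    (π : Measure (EuclideanSpace ℝ (Fin n) × EuclideanSpace ℝ (Fin n))) : Prop :=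
  π.map Prod.fst = μ ∧ π.map Prod.snd = ν

/-- The topological support of a measure. -/
def measureSupport {α : Type*} [TopologicalSpace α] [MeasurableSpace α]
    (μ : Measure α) : Set α :=
  {x | ∀ U ∈ nhds x, μ U ≠ 0}

lemma aux_ae_support {n : ℕ} (μ : Measure (EuclideanSpace ℝ (Fin n))) :
    ∀ᵐ x ∂μ, x ∈ measureSupport μ := by
  filter_upwards [Measure.support_mem_ae (μ := μ)] with x hx
  intro U hU
  exact ((Measure.mem_support_iff_forall x).1 hx U hU).ne'

lemma aux_norm_gradient {n : ℕ} (f : EuclideanSpace ℝ (Fin n) → ℝ)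
    (x : EuclideanSpace ℝ (Fin n)) : ‖gradient f x‖ = ‖fderiv ℝ f x‖ := by
  simp [gradient]

lemma aux_line {n : ℕ} (f : EuclideanSpace ℝ (Fin n) → ℝ) (hf : ContDiff ℝ 1 f)
    (x y : EuclideanSpace ℝ (Fin n)) (h : SobolevLineConstraint f x y) :
    f x - f y ≤ ‖x - y‖ := by
  unfold SobolevLineConstraint at h
  simp only [aux_norm_gradient] at h
  rw [integral_Icc_eq_integral_Ioc, ← intervalIntegral.integral_of_le zero_le_one] at h
  have hc : Continuous fun t : ℝ => fderiv ℝ f (t • x + (1 - t) • y) :=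
    (hf.continuous_fderiv one_ne_zero).comp (by fun_prop)
  have hl : ∀ t : ℝ, HasDerivAt (fun t : ℝ => t • x + (1 - t) • y) (x - y) t := by
    intro t
    have h1 := (hasDerivAt_id t).smul_const x
    have h2 := ((hasDerivAt_id t).const_sub 1).smul_const y
    convert! h1.add h2 using 1
    simp [sub_eq_add_neg]
  have hd : ∀ t ∈ Set.uIcc (0 : ℝ) 1, HasDerivAt (fun t : ℝ => f (t • x + (1 - t) • y))
      (fderiv ℝ f (t • x + (1 - t) • y) (x - y)) t := fun t _ =>
    ((hf.differentiable one_ne_zero) _).hasFDerivAt.comp_hasDerivAt t (hl t)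
  have hc1 : Continuous fun t : ℝ => fderiv ℝ f (t • x + (1 - t) • y) (x - y) :=
    hc.clm_apply continuous_const
  have hc2 : Continuous fun t : ℝ => ‖fderiv ℝ f (t • x + (1 - t) • y)‖ ^ 2 := hc.norm.pow 2
  have key := intervalIntegral.integral_eq_sub_of_hasDerivAt hd (hc1.intervalIntegrable _ _)
  have e : f x - f y = ∫ t in (0:ℝ)..1, fderiv ℝ f (t • x + (1 - t) • y) (x - y) := by
    rw [key]; simp
  rw [e]
  have hm : ∫ t in (0:ℝ)..1, fderiv ℝ f (t • x + (1 - t) • y) (x - y) ≤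
      ∫ t in (0:ℝ)..1, ‖x - y‖ / 2 * (‖fderiv ℝ f (t • x + (1 - t) • y)‖ ^ 2 + 1) := by
    refine intervalIntegral.integral_mono_on zero_le_one (hc1.intervalIntegrable _ _)
      ((continuous_const.mul (hc2.add continuous_const)).intervalIntegrable _ _) ?_
    intro t _
    have h1 := (le_abs_self _).trans
      ((fderiv ℝ f (t • x + (1 - t) • y)).le_opNorm (x - y))
    nlinarith [norm_nonneg (x - y), mul_nonneg (norm_nonneg (x - y))
      (sq_nonneg (‖fderiv ℝ f (t • x + (1 - t) • y)‖ - 1))]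
  refine hm.trans ?_
  rw [intervalIntegral.integral_const_mul, intervalIntegral.integral_add
    (hc2.intervalIntegrable _ _) (continuous_const.intervalIntegrable _ _)]
  simp only [intervalIntegral.integral_const, sub_zero, smul_eq_mul, mul_one]
  nlinarith [norm_nonneg (x - y)]

lemma aux_mollify {n : ℕ} (f : EuclideanSpace ℝ (Fin n) → ℝ)
    (hf : ∀ u v, |f u - f v| ≤ ‖u - v‖) (ε : ℝ) (hε : 0 < ε) :
    ∃ g : EuclideanSpace ℝ (Fin n) → ℝ, ContDiff ℝ 1 g ∧
      (∀ u v, |g u - g v| ≤ ‖u - v‖) ∧ ∀ x, |g x - f x| ≤ ε := by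
  have hlip : LipschitzWith 1 f := LipschitzWith.of_dist_le_mul fun u v => by
    simpa [Real.dist_eq, dist_eq_norm] using hf u v
  have hfc : Continuous f := hlip.continuous
  let φ : ContDiffBump (0 : EuclideanSpace ℝ (Fin n)) :=
    { rIn := ε / 2, rOut := ε, rIn_pos := half_pos hε, rIn_lt_rOut := half_lt_self hε }
  let g : EuclideanSpace ℝ (Fin n) → ℝ :=
    MeasureTheory.convolution (φ.normed volume) f (ContinuousLinearMap.lsmul ℝ ℝ) volume
  have hg : ∀ x, g x = ∫ t, φ.normed volume t * f (x - t) := fun x => rfl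
  have hint : ∀ x, Integrable (fun t => φ.normed volume t * f (x - t)) := fun x =>
    Continuous.integrable_of_hasCompactSupport
      (φ.continuous_normed.mul (hfc.comp (by fun_prop)))
      (φ.hasCompactSupport_normed.mul_right)
  refine ⟨g, ?_, ?_, ?_⟩
  · exact φ.hasCompactSupport_normed.contDiff_convolution_left _
      (φ.contDiff_normed (n := 1)) hfc.locallyIntegrable
  · intro u v
    rw [hg, hg, ← integral_sub (hint u) (hint v)]
    have hb : ∀ t, ‖φ.normed volume t * f (u - t) - φ.normed volume t * f (v - t)‖ ≤
        φ.normed volume t * ‖u - v‖ := by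
      intro t
      rw [← mul_sub, norm_mul, Real.norm_of_nonneg (φ.nonneg_normed t)]
      refine mul_le_mul_of_nonneg_left ?_ (φ.nonneg_normed t)
      simpa using hf (u - t) (v - t)
    have := norm_integral_le_of_norm_le (φ.integrable_normed.mul_const ‖u - v‖)
      (Filter.Eventually.of_forall hb)
    rwa [integral_mul_const, φ.integral_normed, one_mul] at this
  · intro x
    have := φ.dist_normed_convolution_le (μ := volume) (x₀ := x) (ε := ε) (g := f)
      hfc.aestronglyMeasurable (fun z hz => by
        rw [Real.dist_eq]
        refine (hf z x).trans ?_
        rw [← dist_eq_norm]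
        exact (Metric.mem_ball.1 hz).le)
    rwa [Real.dist_eq] at this

lemma aux_constraint {n : ℕ} (g : EuclideanSpace ℝ (Fin n) → ℝ)
    (hg : ∀ u v, |g u - g v| ≤ ‖u - v‖) (x y : EuclideanSpace ℝ (Fin n)) :
    SobolevLineConstraint g x y := by
  have hlip : LipschitzWith 1 g := LipschitzWith.of_dist_le_mul fun u v => by
    simpa [Real.dist_eq, dist_eq_norm] using hg u v
  unfold SobolevLineConstraint
  simp only [aux_norm_gradient]
  have hb : ∀ t ∈ Set.Icc (0:ℝ) 1, ‖‖fderiv ℝ g (t • x + (1 - t) • y)‖ ^ 2‖ ≤ 1 := by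
    intro t _
    have h1 := norm_fderiv_le_of_lipschitz ℝ hlip (x₀ := t • x + (1 - t) • y)
    rw [Real.norm_of_nonneg (sq_nonneg _)]
    exact pow_le_one₀ (norm_nonneg _) (by simpa using h1)
  have := norm_setIntegral_le_of_norm_le_const (μ := volume) (by simp) hb
  refine (le_abs_self _).trans (this.trans ?_)
  simp

lemma aux_bound {n : ℕ} (μ ν : Measure (EuclideanSpace ℝ (Fin n)))
    (π : Measure (EuclideanSpace ℝ (Fin n) × EuclideanSpace ℝ (Fin n)))
    (hπ : IsCoupling μ ν π)
    (hi : Integrable (fun p : EuclideanSpace ℝ (Fin n) × EuclideanSpace ℝ (Fin n) =>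
          ‖p.1 - p.2‖) π)
    (f : EuclideanSpace ℝ (Fin n) → ℝ) (hf : ContDiff ℝ 1 f)
    (hμ : Integrable f μ) (hν : Integrable f ν)
    (hs : ∀ x ∈ measureSupport μ, ∀ y ∈ measureSupport ν, SobolevLineConstraint f x y) :
    (∫ x, f x ∂μ) - ∫ x, f x ∂ν ≤
      ∫ p : EuclideanSpace ℝ (Fin n) × EuclideanSpace ℝ (Fin n), ‖p.1 - p.2‖ ∂π := by
  obtain ⟨h1, h2⟩ := hπ
  have a1 : ∀ᵐ p ∂π, p.1 ∈ measureSupport μ :=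
    ae_of_ae_map measurable_fst.aemeasurable (by rw [h1]; exact aux_ae_support μ)
  have a2 : ∀ᵐ p ∂π, p.2 ∈ measureSupport ν :=
    ae_of_ae_map measurable_snd.aemeasurable (by rw [h2]; exact aux_ae_support ν)
  have i1 : Integrable (fun p : EuclideanSpace ℝ (Fin n) × EuclideanSpace ℝ (Fin n) => f p.1) π :=
    (h1 ▸ hμ : Integrable f (π.map Prod.fst)).comp_measurable measurable_fst
  have i2 : Integrable (fun p : EuclideanSpace ℝ (Fin n) × EuclideanSpace ℝ (Fin n) => f p.2) π :=
    (h2 ▸ hν : Integrable f (π.map Prod.snd)).comp_measurable measurable_snd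
  have e1 : ∫ x, f x ∂μ = ∫ p, f p.1 ∂π := by
    rw [← h1]
    exact integral_map measurable_fst.aemeasurable hf.continuous.aestronglyMeasurable
  have e2 : ∫ x, f x ∂ν = ∫ p, f p.2 ∂π := by
    rw [← h2]
    exact integral_map measurable_snd.aemeasurable hf.continuous.aestronglyMeasurable
  rw [e1, e2, ← integral_sub i1 i2]
  refine integral_mono_ae (i1.sub i2) hi ?_
  filter_upwards [a1, a2] with p hp1 hp2
  exact aux_line f hf _ _ (hs _ hp1 _ hp2)

theorem sobolev_duality_of_wasserstein
    {n : ℕ} (hn : 0 < n)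
    (μ ν : Measure (EuclideanSpace ℝ (Fin n)))
    [IsProbabilityMeasure μ] [IsProbabilityMeasure ν]
    (hμmom : Integrable (fun x : EuclideanSpace ℝ (Fin n) => ‖x‖) μ)
    (hνmom : Integrable (fun x : EuclideanSpace ℝ (Fin n) => ‖x‖) ν)
    (W₁ : ℝ)
    (hW : W₁ = sInf {c : ℝ |
      ∃ π : Measure (EuclideanSpace ℝ (Fin n) × EuclideanSpace ℝ (Fin n)),
        IsCoupling μ ν π ∧
        Integrable (fun p : EuclideanSpace ℝ (Fin n) × EuclideanSpace ℝ (Fin n) =>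
          ‖p.1 - p.2‖) π ∧
        c = ∫ p : EuclideanSpace ℝ (Fin n) × EuclideanSpace ℝ (Fin n), ‖p.1 - p.2‖ ∂π})
    (A B : Set ℝ)
    (hA : A = {r : ℝ | ∃ f : EuclideanSpace ℝ (Fin n) → ℝ,
      Differentiable ℝ f ∧
      (∀ u v : EuclideanSpace ℝ (Fin n), |f u - f v| ≤ ‖u - v‖) ∧
      Integrable f μ ∧ Integrable f ν ∧
      r = (∫ x, f x ∂μ) - ∫ x, f x ∂ν})
    (hB : B = {r : ℝ | ∃ f : EuclideanSpace ℝ (Fin n) → ℝ,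
      ContDiff ℝ 1 f ∧
      Integrable f μ ∧ Integrable f ν ∧
      (∀ x ∈ measureSupport μ, ∀ y ∈ measureSupport ν, SobolevLineConstraint f x y) ∧
      r = (∫ x, f x ∂μ) - ∫ x, f x ∂ν})
    (hKR : sSup A = W₁) :
    sSup B = W₁ := by
  have hub : ∀ r ∈ B, r ≤ W₁ := by
    intro r hr
    rw [hB] at hr
    obtain ⟨f, hf, h1, h2, hs, rfl⟩ := hr
    rw [hW]
    refine le_csInf ?_ ?_
    · refine ⟨_, μ.prod ν, ⟨by simp, by simp⟩, ?_, rfl⟩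
      have j1 : Integrable (fun p : EuclideanSpace ℝ (Fin n) × EuclideanSpace ℝ (Fin n) => ‖p.1‖)
        (μ.prod ν) := hμmom.comp_fst ν
      have j2 : Integrable (fun p : EuclideanSpace ℝ (Fin n) × EuclideanSpace ℝ (Fin n) => ‖p.2‖)
        (μ.prod ν) := hνmom.comp_snd μ
      refine (j1.add j2).mono' (by fun_prop) (Filter.Eventually.of_forall fun p => ?_)
      simpa using norm_sub_le p.1 p.2
    · rintro c ⟨π, hπ, hi, rfl⟩
      exact aux_bound μ ν π hπ hi f hf h1 h2 hs
  have hbdd : BddAbove B := ⟨W₁, hub⟩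
  have hBne : B.Nonempty := by
    rw [hB]
    exact ⟨0, fun _ => 0, contDiff_const, by simp, by simp,
      fun x _ y _ => aux_constraint _ (by simp) x y, by simp⟩
  have hAne : A.Nonempty := by
    rw [hA]
    exact ⟨0, fun _ => 0, by fun_prop, by simp, by simp, by simp, by simp⟩
  refine le_antisymm (csSup_le hBne hub) ?_
  rw [← hKR]
  refine csSup_le hAne ?_
  intro r hr
  rw [hA] at hr
  obtain ⟨f, -, hlip, h1, h2, rfl⟩ := hr
  refine le_of_forall_pos_le_add fun ε hε => ?_
  obtain ⟨g, hg, hgl, hgf⟩ := aux_mollify f hlip (ε / 2) (half_pos hε)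
  have hfc : Continuous f := (LipschitzWith.of_dist_le_mul (K := 1) fun u v => by
    simpa [Real.dist_eq, dist_eq_norm] using hlip u v).continuous
  have hd : ∀ (ρ : Measure (EuclideanSpace ℝ (Fin n))) [IsProbabilityMeasure ρ],
      Integrable f ρ → Integrable g ρ ∧ |(∫ x, g x ∂ρ) - ∫ x, f x ∂ρ| ≤ ε / 2 := by
    intro ρ _ hfρ
    have hdi : Integrable (fun x => g x - f x) ρ :=
      (integrable_const (ε / 2)).mono' (hg.continuous.sub hfc).aestronglyMeasurable
        (Filter.Eventually.of_forall hgf)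
    have hgi : Integrable g ρ := by
      have := hdi.add hfρ
      refine this.congr (Filter.Eventually.of_forall fun x => ?_)
      simp
    refine ⟨hgi, ?_⟩
    rw [← integral_sub hgi hfρ]
    have := norm_integral_le_of_norm_le_const (μ := ρ) (f := fun x => g x - f x)
      (C := ε / 2) (Filter.Eventually.of_forall hgf)
    simpa using this
  obtain ⟨g1, b1⟩ := hd μ h1
  obtain ⟨g2, b2⟩ := hd ν h2
  have hmem : (∫ x, g x ∂μ) - ∫ x, g x ∂ν ∈ B := by
    rw [hB]
    exact ⟨g, hg, g1, g2, fun x _ y _ => aux_constraint g hgl x y, rfl⟩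
  have := le_csSup hbdd hmem
  have := abs_le.1 b1
  have := abs_le.1 b2
  linarith
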